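/- Fix X > 0. For integers N ≥ 2 with N > X define S_N(θ) := sin(Nθ/2)/(2π sin(θ/2)) for θ ∈ (0,2π), D_N(θ) := S_N'(θ), I_N(θ) := ∫₀^θ S_N(φ)dφ, and ρ_N(X) := (2π/N)²·[ (N/(2π))² − S_N(2πX/N)² + D_N(2πX/N)·(I_N(2πX/N) − 1/2) ]. Let ρ₀(X) := 1 − (sin(πX)/(πX))² + (sin(πX) − πX·cos(πX))·(π − 2·Si(πX))/(2π²X²) and ρ₁(X) := (1/12)·( −4·sin²(πX) − 2·(sin(πX) − πX·cos(πX))²/(π²X²) − (π − 2·Si(πX))·(sin(πX) + πX·cos(πX)) ). Then as N → ∞, ρ_N(X) = ρ₀(X) + ρ₁(X)/N² + O(N⁻⁴); that is, there exist C > 0 and N₀ with |ρ_N(X) − ρ₀(X) − ρ₁(X)/N²| ≤ C·N⁻⁴ for all N ≥ N₀. -/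

import Mathlib

open Real intervalIntegral

/-- The COE kernel entry `S_N(θ) = sin(Nθ/2)/(2π sin(θ/2))`. -/
noncomputable def SNker (N : ℕ) (θ : ℝ) : ℝ :=
  Real.sin (N * θ / 2) / (2 * π * Real.sin (θ / 2))

/-- `I_N(θ) = ∫₀^θ S_N(φ) dφ`. -/
noncomputable def INker (N : ℕ) (θ : ℝ) : ℝ := ∫ φ in (0 : ℝ)..θ, SNker N φ

/-- The sine integral `Si(x) = ∫₀^x (sin t)/t dt`. -/
noncomputable def Si (x : ℝ) : ℝ := ∫ t in (0 : ℝ)..x, Real.sin t / t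

/-- The bulk-scaled two-point correlation function of the `N×N` COE, from its Pfaffian
point process structure: `ρ_N(X) = (2π/N)²[(N/(2π))² − S_N(a)² + D_N(a)(I_N(a) − 1/2)]`
with `a = 2πX/N` and `D_N = S_N'`. -/
noncomputable def rhoCOE (N : ℕ) (X : ℝ) : ℝ :=
  (2 * π / N) ^ 2 *
    ((N / (2 * π)) ^ 2 - SNker N (2 * π * X / N) ^ 2 +
      deriv (SNker N) (2 * π * X / N) * (INker N (2 * π * X / N) - 1 / 2))

/-- The limiting bulk two-point correlation function of the COE. -/
noncomputable def rho0COE (X : ℝ) : ℝ :=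
  1 - (Real.sin (π * X) / (π * X)) ^ 2 +
    (Real.sin (π * X) - π * X * Real.cos (π * X)) * (π - 2 * Si (π * X)) / (2 * π ^ 2 * X ^ 2)

/-- The coefficient of `N⁻²` in the large-`N` expansion of the bulk-scaled COE two-point
correlation function. -/
noncomputable def rho1COE (X : ℝ) : ℝ :=
  (1 / 12) *
    (-4 * Real.sin (π * X) ^ 2 -
      2 * (Real.sin (π * X) - π * X * Real.cos (π * X)) ^ 2 / (π ^ 2 * X ^ 2) -
      (π - 2 * Si (π * X)) * (Real.sin (π * X) + π * X * Real.cos (π * X)))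

/-- `f N = α + β / N² + O(N⁻⁴)`. -/
def HasExp (f : ℕ → ℝ) (α β : ℝ) : Prop :=
  ∃ K : ℝ, 0 ≤ K ∧ ∃ N₀ : ℕ, ∀ N : ℕ, N₀ ≤ N →
    |f N - α - β * ((N : ℝ) ^ 2)⁻¹| ≤ K * (((N : ℝ) ^ 2)⁻¹) ^ 2

lemma HasExp.const (α : ℝ) : HasExp (fun _ => α) α 0 :=
  ⟨0, le_rfl, 0, fun N _ => by simp⟩

lemma HasExp.add {f g : ℕ → ℝ} {α β α' β' : ℝ} (hf : HasExp f α β) (hg : HasExp g α' β') :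
    HasExp (fun N => f N + g N) (α + α') (β + β') := by
  obtain ⟨K, hK, M, h⟩ := hf
  obtain ⟨K', hK', M', h'⟩ := hg
  refine ⟨K + K', by positivity, max M M', fun N hN => ?_⟩
  have h1 := h N (le_trans (le_max_left _ _) hN)
  have h2 := h' N (le_trans (le_max_right _ _) hN)
  have h3 := abs_add_le (f N - α - β * ((N : ℝ) ^ 2)⁻¹) (g N - α' - β' * ((N : ℝ) ^ 2)⁻¹)
  have e : f N + g N - (α + α') - (β + β') * ((N : ℝ) ^ 2)⁻¹ =
    (f N - α - β * ((N : ℝ) ^ 2)⁻¹) + (g N - α' - β' * ((N : ℝ) ^ 2)⁻¹) := by ring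
  rw [e]
  linarith

lemma HasExp.mul {f g : ℕ → ℝ} {α β α' β' : ℝ} (hf : HasExp f α β) (hg : HasExp g α' β') :
    HasExp (fun N => f N * g N) (α * α') (α * β' + α' * β) := by
  obtain ⟨K, hK, M, h⟩ := hf
  obtain ⟨K', hK', M', h'⟩ := hg
  refine ⟨|β * β'| + K * (|α'| + |β'| + K') + (|α| + |β|) * K', by positivity,
    max 1 (max M M'), fun N hN => ?_⟩
  have h1 := h N (le_trans (le_trans (le_max_left _ _) (le_max_right _ _)) hN)
  have h2 := h' N (le_trans (le_trans (le_max_right _ _) (le_max_right _ _)) hN)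
  have hN1 : (1 : ℝ) ≤ N := by exact_mod_cast le_trans (le_max_left _ _) hN
  have he0 : 0 ≤ ((N : ℝ) ^ 2)⁻¹ := by positivity
  have he1 : ((N : ℝ) ^ 2)⁻¹ ≤ 1 := inv_le_one_of_one_le₀ (one_le_pow₀ hN1)
  simp only
  generalize ((N : ℝ) ^ 2)⁻¹ = e at *
  obtain ⟨r, hr⟩ : ∃ r, r = f N - α - β * e := ⟨_, rfl⟩
  obtain ⟨r', hr'⟩ : ∃ r, r = g N - α' - β' * e := ⟨_, rfl⟩
  rw [← hr] at h1
  rw [← hr'] at h2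
  have hfe : f N = α + β * e + r := by rw [hr]; ring
  have hge : g N = α' + β' * e + r' := by rw [hr']; ring
  have he2 : e ^ 2 ≤ 1 := pow_le_one₀ he0 he1
  have hb : ∀ b : ℝ, |b * e| ≤ |b| := fun b => by
    rw [abs_mul, abs_of_nonneg he0]
    exact mul_le_of_le_one_right (abs_nonneg _) he1
  have hg2 : |α' + β' * e + r'| ≤ |α'| + |β'| + K' := by
    have := abs_add_three α' (β' * e) r'
    have := hb β'
    nlinarith
  have hf2 : |α + β * e| ≤ |α| + |β| := by
    have := abs_add_le α (β * e)
    have := hb β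
    linarith
  have key : f N * g N - α * α' - (α * β' + α' * β) * e =
      β * β' * e ^ 2 + r * (α' + β' * e + r') + (α + β * e) * r' := by
    rw [hfe, hge]; ring
  rw [key]
  calc _ ≤ |β * β' * e ^ 2| + |r * (α' + β' * e + r')| + |(α + β * e) * r'| := abs_add_three _ _ _
    _ ≤ |β * β'| * e ^ 2 + (K * e ^ 2) * (|α'| + |β'| + K') + (|α| + |β|) * (K' * e ^ 2) := by
      rw [abs_mul (β * β'), abs_mul r, abs_mul (α + β * e), abs_of_nonneg (sq_nonneg e)]
      gcongr
    _ = _ := by ring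

lemma HasExp.congr {f g : ℕ → ℝ} {α β α' β' : ℝ} (hf : HasExp f α β)
    (N₁ : ℕ) (h : ∀ N, N₁ ≤ N → g N = f N) (hα : α' = α) (hβ : β' = β) : HasExp g α' β' := by
  obtain ⟨K, hK, M, h1⟩ := hf
  subst hα hβ
  refine ⟨K, hK, max N₁ M, fun N hN => ?_⟩
  rw [h N (le_trans (le_max_left _ _) hN)]
  exact h1 N (le_trans (le_max_right _ _) hN)

lemma inv_sinc_bound {h : ℝ} (h0 : 0 < h) (h1 : h ≤ 1) :
    |h / sin h - 1 - h ^ 2 / 6| ≤ h ^ 4 := by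
  have hb := sin_bound (x := h) (by rw [abs_of_pos h0]; exact h1)
  rw [abs_of_pos h0] at hb
  obtain ⟨hb1, hb2⟩ := abs_le.1 hb
  have h5 : h ^ 5 ≤ h ^ 3 := pow_le_pow_of_le_one h0.le h1 (by norm_num)
  have h3 : h ^ 3 ≤ h := by simpa using pow_le_pow_of_le_one h0.le h1 (show 1 ≤ 3 by norm_num)
  have hs : h / 2 ≤ sin h := by linarith
  have hs0 : 0 < sin h := by linarith
  have e : h / sin h - 1 - h ^ 2 / 6 = (h - (1 + h ^ 2 / 6) * sin h) / sin h := by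
    field_simp
    ring
  rw [e, abs_div, abs_of_pos hs0, div_le_iff₀ hs0]
  have p5 : 0 < h ^ 5 := by positivity
  have p2 : h ^ 2 ≤ 1 := pow_le_one₀ h0.le h1
  obtain ⟨d, hd⟩ : ∃ d, d = sin h - (h - h ^ 3 / 6) := ⟨_, rfl⟩
  rw [← hd] at hb1 hb2
  have e2 : h - (1 + h ^ 2 / 6) * sin h = h ^ 5 / 36 - (1 + h ^ 2 / 6) * d := by rw [hd]; ring
  have hd2 : |(1 + h ^ 2 / 6) * d| ≤ 2 * (h ^ 5 / 100) := by
    rw [abs_mul, abs_of_pos (by positivity)]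
    gcongr
    · linarith
    · exact abs_le.2 ⟨hb1, hb2⟩
  have hl : h ^ 4 * (h / 2) ≤ h ^ 4 * sin h := by gcongr
  have : h ^ 4 * (h / 2) = h ^ 5 / 2 := by ring
  obtain ⟨q1, q2⟩ := abs_le.1 hd2
  rw [e2, abs_le]
  constructor <;> linarith

lemma exp_P {a : ℝ} (ha : 0 < a) :
    HasExp (fun N => (a / N) / sin (a / N)) 1 (a ^ 2 / 6) := by
  refine ⟨a ^ 4, by positivity, max 1 ⌈a⌉₊, fun N hN => ?_⟩
  have hN1 : (1 : ℝ) ≤ N := by exact_mod_cast le_trans (le_max_left _ _) hN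
  have hNa : a ≤ N := (Nat.le_ceil a).trans (by exact_mod_cast le_trans (le_max_right _ _) hN)
  have hN0 : (0 : ℝ) < N := by linarith
  have := inv_sinc_bound (h := a / N) (by positivity) ((div_le_one hN0).2 hNa)
  convert this using 1
  · congr 1; field_simp
  · field_simp

lemma exp_Q {a : ℝ} (ha : 0 < a) :
    HasExp (fun N => cos (a / N)) 1 (-a ^ 2 / 2) := by
  refine ⟨a ^ 4 * (5 / 96), by positivity, max 1 ⌈a⌉₊, fun N hN => ?_⟩
  have hN1 : (1 : ℝ) ≤ N := by exact_mod_cast le_trans (le_max_left _ _) hN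
  have hNa : a ≤ N := (Nat.le_ceil a).trans (by exact_mod_cast le_trans (le_max_right _ _) hN)
  have hN0 : (0 : ℝ) < N := by linarith
  have hp : 0 < a / N := by positivity
  have := cos_bound (x := a / N) (by rw [abs_of_pos hp]; exact (div_le_one hN0).2 hNa)
  rw [abs_of_pos hp] at this
  convert this using 1
  · congr 1; field_simp; ring
  · field_simp

lemma Si_eq (a : ℝ) : Si a = ∫ t in (0 : ℝ)..a, sinc t := by
  unfold Si
  apply integral_congr_ae
  filter_upwards [MeasureTheory.Measure.ae_ne MeasureTheory.volume (0 : ℝ)] with t ht _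
  rw [sinc_of_ne_zero ht]

lemma integral_t_sin (a : ℝ) : ∫ t in (0 : ℝ)..a, t * sin t = sin a - a * cos a := by
  rw [integral_eq_sub_of_hasDerivAt (f := fun t => sin t - t * cos t)]
  · simp
  · intro x _
    have := (hasDerivAt_sin x).sub ((hasDerivAt_id x).mul (hasDerivAt_cos x))
    exact this.congr_deriv (by simp only [id]; ring)
  · exact (by fun_prop : Continuous fun t : ℝ => t * sin t).intervalIntegrable _ _

lemma IN_eq {a : ℝ} {N : ℕ} (hN : (0 : ℝ) < N) :
    INker N (2 * a / N) = (1 / π) * ∫ t in (0 : ℝ)..a, sin t / (N * sin (t / N)) := by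
  unfold INker
  have := smul_integral_comp_mul_left (a := 0) (b := a) (SNker N) (2 / N)
  rw [mul_zero, show 2 / (N : ℝ) * a = 2 * a / N by ring] at this
  rw [← this, smul_eq_mul, ← integral_const_mul, ← integral_const_mul]
  congr 1
  ext t
  unfold SNker
  rw [show (N : ℝ) * (2 / N * t) / 2 = t by field_simp, show 2 / (N : ℝ) * t / 2 = t / N by ring]
  have := pi_pos.ne'
  field_simp

lemma exp_J {a : ℝ} (ha : 0 < a) :
    HasExp (fun N => ∫ t in (0 : ℝ)..a, sin t / (N * sin (t / N))) (Si a)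
      ((sin a - a * cos a) / 6) := by
  refine ⟨a ^ 5, by positivity, max 1 ⌈a⌉₊, fun N hN => ?_⟩
  have hN1 : (1 : ℝ) ≤ N := by exact_mod_cast le_trans (le_max_left _ _) hN
  have hNa : a ≤ N := (Nat.le_ceil a).trans (by exact_mod_cast le_trans (le_max_right _ _) hN)
  have hN0 : (0 : ℝ) < N := by linarith
  have hsp : ∀ t, 0 < t → t ≤ a → 0 < t / N ∧ t / N ≤ 1 ∧ 0 < sin (t / N) := fun t h0 h1 => by
    have p : 0 < t / N := by positivity
    have q : t / N ≤ 1 := (div_le_one hN0).2 (h1.trans hNa)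
    exact ⟨p, q, sin_pos_of_pos_of_le_one p q⟩
  have e1 : ∫ t in (0 : ℝ)..a, sin t / (N * sin (t / N)) =
      ∫ t in (0 : ℝ)..a, sinc t / sinc (t / N) := by
    apply integral_congr_Ioo_of_le ha.le
    intro t ht
    obtain ⟨p, q, r⟩ := hsp t ht.1 ht.2.le
    have := ht.1.ne'
    simp only
    rw [sinc_of_ne_zero this, sinc_of_ne_zero p.ne']
    field_simp
  have i1 : IntervalIntegrable (fun t => sinc t / sinc (t / N)) MeasureTheory.volume 0 a := by
    apply ContinuousOn.intervalIntegrable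
    apply continuous_sinc.continuousOn.div
    · exact (continuous_sinc.comp (continuous_id.div_const _)).continuousOn
    · intro t ht
      rw [Set.uIcc_of_le ha.le] at ht
      rcases ht.1.eq_or_lt with h | h
      · simp [← h]
      · obtain ⟨p, q, r⟩ := hsp t h ht.2
        rw [sinc_of_ne_zero p.ne']
        positivity
  have i2 : IntervalIntegrable sinc MeasureTheory.volume 0 a :=
    continuous_sinc.intervalIntegrable _ _
  have i3 : IntervalIntegrable (fun t => t * sin t * (1 / 6 * ((N : ℝ) ^ 2)⁻¹))
      MeasureTheory.volume 0 a :=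
    (by fun_prop : Continuous fun t : ℝ =>
      t * sin t * (1 / 6 * ((N : ℝ) ^ 2)⁻¹)).intervalIntegrable _ _
  have e2 : (sin a - a * cos a) / 6 * ((N : ℝ) ^ 2)⁻¹ =
      ∫ t in (0 : ℝ)..a, t * sin t * (1 / 6 * ((N : ℝ) ^ 2)⁻¹) := by
    rw [integral_mul_const, integral_t_sin]; ring
  simp only
  rw [e1, e2, Si_eq, ← integral_sub i1 i2, ← integral_sub (i1.sub i2) i3, ← Real.norm_eq_abs]
  refine (norm_integral_le_of_norm_le_const (C := a ^ 4 * (((N : ℝ) ^ 2)⁻¹) ^ 2) ?_).trans ?_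
  · intro t ht
    rw [Set.uIoc_of_le ha.le] at ht
    obtain ⟨p, q, r⟩ := hsp t ht.1 ht.2
    have ht0 := ht.1.ne'
    have e : sinc t / sinc (t / N) - sinc t - t * sin t * (1 / 6 * ((N : ℝ) ^ 2)⁻¹) =
        sinc t * ((t / N) / sin (t / N) - 1 - (t / N) ^ 2 / 6) := by
      rw [sinc_of_ne_zero p.ne', sinc_of_ne_zero ht0]
      field_simp
    rw [Real.norm_eq_abs, e, abs_mul]
    calc _ ≤ 1 * (t / N) ^ 4 := by
          gcongr
          · exact abs_sinc_le_one t
          · exact inv_sinc_bound p q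
      _ ≤ 1 * (a / N) ^ 4 := by
          have := ht.2
          gcongr
      _ = _ := by field_simp
  · rw [sub_zero, abs_of_pos ha]
    apply le_of_eq; ring

lemma deriv_SN (N : ℕ) (θ : ℝ) (h : sin (θ / 2) ≠ 0) :
    deriv (SNker N) θ = ((N / 2) * cos (N * θ / 2) * sin (θ / 2) -
      sin (N * θ / 2) * (cos (θ / 2) / 2)) / (2 * π * sin (θ / 2) ^ 2) := by
  have hn : HasDerivAt (fun θ : ℝ => sin (N * θ / 2)) (cos (N * θ / 2) * (N * 1 / 2)) θ :=
    (((hasDerivAt_id θ).const_mul (N : ℝ)).div_const 2).sin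
  have hd : HasDerivAt (fun θ : ℝ => 2 * π * sin (θ / 2)) (2 * π * (cos (θ / 2) * (1 / 2))) θ :=
    (((hasDerivAt_id θ).div_const 2).sin).const_mul _
  have hpi := pi_pos.ne'
  have := (hn.div hd (by positivity)).deriv
  have e : SNker N = (fun θ : ℝ => sin (N * θ / 2)) / (fun θ : ℝ => 2 * π * sin (θ / 2)) := by
    ext; rfl
  rw [e, this]
  field_simp

lemma rho_eq {X : ℝ} (hX : 0 < X) {N : ℕ} (hN1 : 1 ≤ N) (hNa : π * X ≤ N) :
    rhoCOE N X = 1 + (-(sin (π * X) / (π * X)) ^ 2) *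
        ((π * X / N / sin (π * X / N)) * (π * X / N / sin (π * X / N))) +
      (π / (π * X) ^ 2) * (π * X * cos (π * X) * (π * X / N / sin (π * X / N)) +
        (-sin (π * X)) * (cos (π * X / N) *
          ((π * X / N / sin (π * X / N)) * (π * X / N / sin (π * X / N))))) *
      ((1 / π) * (∫ t in (0 : ℝ)..(π * X), sin t / (N * sin (t / N))) + (-1 / 2)) := by
  have hN0 : (0 : ℝ) < N := by exact_mod_cast hN1
  have hpi := pi_pos
  have p : 0 < π * X / N := by positivity
  have q : π * X / N ≤ 1 := (div_le_one hN0).2 hNa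
  have hs := sin_pos_of_pos_of_le_one p q
  have e1 : 2 * π * X / N / 2 = π * X / N := by ring
  have e2 : (N : ℝ) * (2 * π * X / N) / 2 = π * X := by field_simp
  unfold rhoCOE
  rw [deriv_SN _ _ (by rw [e1]; exact hs.ne'), e1, e2,
    show 2 * π * X / N = 2 * (π * X) / N by ring, IN_eq hN0]
  unfold SNker
  rw [show 2 * (π * X) / N / 2 = π * X / N by ring,
    show (N : ℝ) * (2 * (π * X) / N) / 2 = π * X by field_simp]
  generalize (∫ t in (0 : ℝ)..(π * X), sin t / (N * sin (t / N))) = J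
  generalize sin (π * X / N) = s at *
  generalize cos (π * X / N) = c at *
  generalize sin (π * X) = s' at *
  generalize cos (π * X) = c' at *
  field_simp
  ring

/-- Large-`N` expansion of the bulk-scaled COE two-point correlation function to order
`N⁻²`, with error `O(N⁻⁴)`. -/
theorem coe_two_point_large_N_expansion (X : ℝ) (hX : 0 < X) :
    ∃ C > (0 : ℝ), ∃ N₀ : ℕ, ∀ N : ℕ, N₀ ≤ N →
      |rhoCOE N X - rho0COE X - rho1COE X / N ^ 2| ≤ C / N ^ 4 := by
  have hpi := pi_pos
  have ha : 0 < π * X := by positivity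
  have P := exp_P ha
  have Q := exp_Q ha
  have J := exp_J ha
  have A := ((HasExp.const 1).add ((HasExp.const (-(sin (π * X) / (π * X)) ^ 2)).mul
    (P.mul P))).add (((HasExp.const (π / (π * X) ^ 2)).mul
      (((HasExp.const (π * X * cos (π * X))).mul P).add
        ((HasExp.const (-sin (π * X))).mul (Q.mul (P.mul P))))).mul
      (((HasExp.const (1 / π)).mul J).add (HasExp.const (-1 / 2))))
  have B : HasExp (fun N => rhoCOE N X) (rho0COE X) (rho1COE X) := by
    refine A.congr (max 1 ⌈π * X⌉₊) (fun N hN => ?_) ?_ ?_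
    · exact rho_eq hX (le_trans (le_max_left _ _) hN)
        ((Nat.le_ceil _).trans (by exact_mod_cast le_trans (le_max_right _ _) hN))
    · unfold rho0COE
      field_simp
      ring
    · unfold rho1COE
      field_simp
      ring
  obtain ⟨K, hK, M, h⟩ := B
  refine ⟨K + 1, by linarith, M, fun N hN => ?_⟩
  have := h N hN
  rw [← div_eq_mul_inv] at this
  refine this.trans ?_
  rw [inv_pow, ← pow_mul, ← div_eq_mul_inv]
  gcongr
  linarith
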